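/- Let H : E × E × ℝ → ℝ be C¹ with (∂H/∂u)(x,p,u) ≥ λ for some λ > 0 and all (x,p,u), and let z : I → E × E × ℝ be a solution of the contact Hamiltonian ODE associated to H on an interval I containing 0. If e₋ ≤ 0 ≤ e₊ and e₋ ≤ H(z(0)) ≤ e₊, then e₋ ≤ H(z(t)) ≤ e₊ for every t ∈ I with t ≥ 0. In particular, the sets H⁻¹(0) and H⁻¹((−∞, δ)) for δ > 0 are forward invariant along solutions. -/

import Mathlib

open scoped RealInnerProductSpace

noncomputable def pgradX {n : ℕ}
    (H : EuclideanSpace ℝ (Fin n) × EuclideanSpace ℝ (Fin n) × ℝ → ℝ)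
    (z : EuclideanSpace ℝ (Fin n) × EuclideanSpace ℝ (Fin n) × ℝ) :
    EuclideanSpace ℝ (Fin n) :=
  gradient (fun x => H (x, z.2.1, z.2.2)) z.1

noncomputable def pgradP {n : ℕ}
    (H : EuclideanSpace ℝ (Fin n) × EuclideanSpace ℝ (Fin n) × ℝ → ℝ)
    (z : EuclideanSpace ℝ (Fin n) × EuclideanSpace ℝ (Fin n) × ℝ) :
    EuclideanSpace ℝ (Fin n) :=
  gradient (fun p => H (z.1, p, z.2.2)) z.2.1

noncomputable def pderivU {n : ℕ}
    (H : EuclideanSpace ℝ (Fin n) × EuclideanSpace ℝ (Fin n) × ℝ → ℝ)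
    (z : EuclideanSpace ℝ (Fin n) × EuclideanSpace ℝ (Fin n) × ℝ) : ℝ :=
  deriv (fun u => H (z.1, z.2.1, u)) z.2.2

/-- `z = (x,p,u)` solves the contact Hamiltonian ODE associated to `H` on `I`. -/
def IsContactSol {n : ℕ}
    (H : EuclideanSpace ℝ (Fin n) × EuclideanSpace ℝ (Fin n) × ℝ → ℝ)
    (I : Set ℝ) (x p : ℝ → EuclideanSpace ℝ (Fin n)) (u : ℝ → ℝ) : Prop :=
  ∀ t ∈ I,
    HasDerivAt x (pgradP H (x t, p t, u t)) t ∧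
    HasDerivAt p (-pgradX H (x t, p t, u t) - pderivU H (x t, p t, u t) • p t) t ∧
    HasDerivAt u (⟪pgradP H (x t, p t, u t), p t⟫ - H (x t, p t, u t)) t

/-- A linear decay equation `g' = -c g` with `c > 0` keeps `g` below any nonnegative upper bound
of its initial value. -/
lemma le_of_hasDerivAt_neg_mul {g c : ℝ → ℝ} {a b e : ℝ} (hab : a ≤ b)
    (hc : ∀ t ∈ Set.Icc a b, 0 < c t)
    (hg : ∀ t ∈ Set.Icc a b, HasDerivAt g (-c t * g t) t) (he : 0 ≤ e) (h0 : g a ≤ e) :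
    g b ≤ e := by
  refine le_of_forall_pos_le_add fun ε hε => ?_
  refine image_le_of_deriv_right_lt_deriv_boundary (f' := fun t => -c t * g t)
    (B := fun _ => e + ε) (B' := fun _ => 0)
    (fun t ht => (hg t ht).continuousAt.continuousWithinAt)
    (fun t ht => (hg t (Set.Ico_subset_Icc_self ht)).hasDerivWithinAt) (by linarith)
    (fun t => hasDerivAt_const t _) (fun t ht heq => ?_) (Set.right_mem_Icc.2 hab)
  have hct := hc t (Set.Ico_subset_Icc_self ht)
  have hgt : 0 < g t := by rw [heq]; positivity
  nlinarith [mul_pos hct hgt]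

/-- Along a contact Hamiltonian solution, `H` satisfies `(H ∘ z)' = -(∂H/∂u) H`. -/
lemma IsContactSol.hasDerivAt_hamiltonian {n : ℕ}
    {H : EuclideanSpace ℝ (Fin n) × EuclideanSpace ℝ (Fin n) × ℝ → ℝ}
    {I : Set ℝ} {x p : ℝ → EuclideanSpace ℝ (Fin n)} {u : ℝ → ℝ}
    (hsol : IsContactSol H I x p u) {t : ℝ} (ht : t ∈ I)
    (hH : DifferentiableAt ℝ H (x t, p t, u t)) :
    HasDerivAt (fun s => H (x s, p s, u s))
      (-pderivU H (x t, p t, u t) * H (x t, p t, u t)) t := by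
  obtain ⟨hx, hp, hu⟩ := hsol t ht
  set L := fderiv ℝ H (x t, p t, u t) with hL
  have hF : HasFDerivAt H L (x t, p t, u t) := hH.hasFDerivAt
  have hX : ∀ v, ⟪pgradX H (x t, p t, u t), v⟫ = L (v, 0, 0) := fun v => by
    have h := hF.comp (x t) ((hasFDerivAt_id (𝕜 := ℝ) (x t)).prodMk
      (hasFDerivAt_const (p t, u t) (x t)))
    have h' : fderiv ℝ (fun y => H (y, p t, u t)) (x t) = _ := h.fderiv
    simp only [pgradX, gradient, InnerProductSpace.toDual_symm_apply, h']
    rfl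
  have hP : ∀ v, ⟪pgradP H (x t, p t, u t), v⟫ = L (0, v, 0) := fun v => by
    have h := hF.comp (p t) ((hasFDerivAt_const (𝕜 := ℝ) (x t) (p t)).prodMk
      ((hasFDerivAt_id (p t)).prodMk (hasFDerivAt_const (u t) (p t))))
    have h' : fderiv ℝ (fun y => H (x t, y, u t)) (p t) = _ := h.fderiv
    simp only [pgradP, gradient, InnerProductSpace.toDual_symm_apply, h']
    rfl
  have hU : pderivU H (x t, p t, u t) = L (0, 0, 1) := by
    have h := hF.comp_hasDerivAt (u t) ((hasDerivAt_const (u t) (x t)).prodMk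
      ((hasDerivAt_const (u t) (p t)).prodMk (hasDerivAt_id (u t))))
    exact h.deriv
  have hsplit : ∀ (v w : EuclideanSpace ℝ (Fin n)) (r : ℝ),
      L (v, w, r) = ⟪pgradX H (x t, p t, u t), v⟫ + ⟪pgradP H (x t, p t, u t), w⟫
        + r * pderivU H (x t, p t, u t) := fun v w r => by
    rw [hX, hP, hU, ← smul_eq_mul, ← map_smul, ← map_add, ← map_add]
    simp
  refine (hF.comp_hasDerivAt t (hx.prodMk (hp.prodMk hu))).congr_deriv ?_
  rw [hsplit, inner_sub_right, inner_neg_right, inner_smul_right,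
    real_inner_comm (pgradP H (x t, p t, u t)) (pgradX H (x t, p t, u t))]
  ring

theorem stmt_3 {n : ℕ} (hn : 1 ≤ n)
    (H : EuclideanSpace ℝ (Fin n) × EuclideanSpace ℝ (Fin n) × ℝ → ℝ) (hH : ContDiff ℝ 1 H)
    (lam : ℝ) (hlam : 0 < lam) (hmono : ∀ z, lam ≤ pderivU H z)
    (I : Set ℝ) (hI : I.OrdConnected) (h0I : (0:ℝ) ∈ I)
    (x p : ℝ → EuclideanSpace ℝ (Fin n)) (u : ℝ → ℝ)
    (hsol : IsContactSol H I x p u) :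
    (∀ em ep : ℝ, em ≤ 0 → 0 ≤ ep →
      em ≤ H (x 0, p 0, u 0) → H (x 0, p 0, u 0) ≤ ep →
      ∀ t ∈ I, 0 ≤ t → em ≤ H (x t, p t, u t) ∧ H (x t, p t, u t) ≤ ep) ∧
    (H (x 0, p 0, u 0) = 0 → ∀ t ∈ I, 0 ≤ t → H (x t, p t, u t) = 0) ∧
    (∀ δ : ℝ, 0 < δ → H (x 0, p 0, u 0) < δ →
      ∀ t ∈ I, 0 ≤ t → H (x t, p t, u t) < δ) := by
  have hbound : ∀ em ep : ℝ, em ≤ 0 → 0 ≤ ep →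
      em ≤ H (x 0, p 0, u 0) → H (x 0, p 0, u 0) ≤ ep →
      ∀ t ∈ I, 0 ≤ t → em ≤ H (x t, p t, u t) ∧ H (x t, p t, u t) ≤ ep := by
    intro em ep hem hep hm hp t ht ht0
    have hd : ∀ s ∈ Set.Icc 0 t, HasDerivAt (fun s => H (x s, p s, u s))
        (-pderivU H (x s, p s, u s) * H (x s, p s, u s)) s := fun s hs =>
      hsol.hasDerivAt_hamiltonian (hI.out h0I ht hs) (hH.differentiable one_ne_zero _)
    have hc : ∀ s ∈ Set.Icc 0 t, 0 < pderivU H (x s, p s, u s) := fun s _ =>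
      hlam.trans_le (hmono _)
    refine ⟨?_, le_of_hasDerivAt_neg_mul ht0 hc hd hep hp⟩
    exact neg_le_neg_iff.1 (le_of_hasDerivAt_neg_mul (g := fun s => -H (x s, p s, u s)) ht0 hc
      (fun s hs => (hd s hs).fun_neg.congr_deriv (by ring)) (neg_nonneg.2 hem) (neg_le_neg hm))
  refine ⟨hbound, fun h0 t ht ht0 => ?_, fun δ hδ h0 t ht ht0 => ?_⟩
  · have h := hbound 0 0 le_rfl le_rfl h0.ge h0.le t ht ht0
    exact le_antisymm h.2 h.1
  · exact (hbound _ _ (min_le_right _ 0) (le_max_right _ 0) (min_le_left _ _) (le_max_left _ _)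
      t ht ht0).2.trans_lt (max_lt h0 hδ)
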